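/- arXiv:1201.4572 — 2 statements merged into one kernel-verified Lean document; each statement's English description precedes it below -/
import Mathlib

section
/- Fix integers n ≥ 2, j with 1 ≤ j ≤ n−1, and l with j+1 ≤ l ≤ n. Let ν = (ν_1, ν_2, …, ν_n) be the partition of n(n−1) given by ν_i = 2(n−i) for all i ∉ {j, l}, ν_j = 2(n−j) − 1, and ν_l = 2(n−l) + 1. Then ⟨a_{δ_n}^2, s_ν⟩ = (−1)^{l−j} · 3 · 2^{l−j−1}. -/
open MvPolynomial Finset

/-- The Vandermonde determinant `a_{δ_n} = ∏_{1 ≤ i < j ≤ n} (x_i - x_j)`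
as a multivariate polynomial over `ℤ` in variables indexed by `Fin n`. -/
noncomputable def vandermondePoly (n : ℕ) : MvPolynomial (Fin n) ℤ :=
  ∏ p ∈ Finset.univ.filter (fun p : Fin n × Fin n => p.1 < p.2), (X p.1 - X p.2)

/-- `⟨a_{δ_n}^{2k}, s_λ⟩`: the coefficient of the Schur function `s_λ` in the expansion
of `a_{δ_n}^{2k}`, i.e. the coefficient of the monomial
`x^{λ+δ_n} = x_1^{λ_1+n-1} x_2^{λ_2+n-2} ⋯ x_n^{λ_n}` in `a_{δ_n}^{2k+1}`.
Here `lam i` is the part `λ_{i+1}` (0-indexed) and `δ_n` has `i`-th entry `n - 1 - i`. -/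
noncomputable def schurCoeff (n k : ℕ) (lam : Fin n → ℕ) : ℤ :=
  MvPolynomial.coeff
    (Finsupp.equivFunOnFinite.symm fun i : Fin n => lam i + (n - 1 - (i : ℕ)))
    (vandermondePoly n ^ (2 * k + 1))

theorem finSuccEquiv_vandermondePoly (n : ℕ) :
    finSuccEquiv ℤ n (vandermondePoly (n + 1)) =
      (∏ k : Fin n, (Polynomial.X - Polynomial.C (X k))) * Polynomial.C (vandermondePoly n) := by
  simp only [vandermondePoly, Finset.prod_filter, Fintype.prod_prod_type]
  rw [Fin.prod_univ_succ]
  simp only [Fin.prod_univ_succ (n := n), lt_self_iff_false, if_false, one_mul, Fin.succ_pos,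
    if_true, Fin.not_lt_zero, Fin.succ_lt_succ_iff, map_mul, map_prod, map_sub, apply_ite,
    map_one, finSuccEquiv_X_zero, finSuccEquiv_X_succ]

/-- The exponent vector `3 δ_n` of the leading monomial of `a_{δ_n}^3`. -/
noncomputable def tripleStaircase (n : ℕ) : Fin n →₀ ℕ :=
  Finsupp.equivFunOnFinite.symm fun i => 3 * (n - 1 - (i : ℕ))

theorem tripleStaircase_succ (n : ℕ) :
    tripleStaircase (n + 1) = (tripleStaircase n).cons (3 * n) := by
  ext i
  cases i using Fin.cases with
  | zero => simp [tripleStaircase]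
  | succ i => simp [tripleStaircase]; omega

theorem tripleStaircase_succ_add_single_zero (n : ℕ) :
    tripleStaircase (n + 1) + Finsupp.single 0 1 = (tripleStaircase n).cons (3 * n + 1) := by
  rw [tripleStaircase_succ]
  ext i
  cases i using Fin.cases <;> simp

theorem tripleStaircase_succ_add_single_succ (n : ℕ) (b : Fin n) :
    tripleStaircase (n + 1) + Finsupp.single b.succ 1 =
      (tripleStaircase n + Finsupp.single b 1).cons (3 * n) := by
  rw [tripleStaircase_succ]
  ext i
  cases i using Fin.cases <;> simp [Finsupp.single_apply]

theorem finSuccEquiv_vandermondePoly_cube (n : ℕ) :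
    finSuccEquiv ℤ n (vandermondePoly (n + 1) ^ 3) =
      (∏ k : Fin n, (Polynomial.X - Polynomial.C (X k))) ^ 3 *
        Polynomial.C (vandermondePoly n ^ 3) := by
  rw [map_pow, finSuccEquiv_vandermondePoly, mul_pow, map_pow]

section Cube

variable {R : Type*} [CommRing R] {n : ℕ} (f : Fin n → R)

theorem monic_prod_X_sub_C_cube :
    ((∏ k, (Polynomial.X - Polynomial.C (f k))) ^ 3).Monic :=
  (Polynomial.monic_prod_X_sub_C f univ).pow 3

theorem natDegree_prod_X_sub_C_cube [Nontrivial R] :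
    ((∏ k, (Polynomial.X - Polynomial.C (f k))) ^ 3).natDegree = 3 * n := by
  rw [(Polynomial.monic_prod_X_sub_C f univ).natDegree_pow,
    Polynomial.natDegree_prod_of_monic _ _ fun k _ => Polynomial.monic_X_sub_C (f k)]
  simp

theorem coeff_prod_X_sub_C_cube [Nontrivial R] :
    ((∏ k, (Polynomial.X - Polynomial.C (f k))) ^ 3).coeff (3 * n) = 1 := by
  simpa [Polynomial.Monic, Polynomial.leadingCoeff, natDegree_prod_X_sub_C_cube f] using
    monic_prod_X_sub_C_cube f

theorem coeff_prod_X_sub_C_cube_pred [Nontrivial R] (hn : 0 < n) :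
    ((∏ k, (Polynomial.X - Polynomial.C (f k))) ^ 3).coeff (3 * n - 1) = -3 * ∑ k, f k := by
  have h := (Polynomial.monic_prod_X_sub_C f univ).nextCoeff_pow 3
  rw [Polynomial.prod_X_sub_C_nextCoeff, Polynomial.nextCoeff_of_natDegree_pos
    (by rw [natDegree_prod_X_sub_C_cube]; omega), natDegree_prod_X_sub_C_cube] at h
  rw [h]
  simp

end Cube

theorem coeff_tripleStaircase (n : ℕ) :
    coeff (tripleStaircase n) (vandermondePoly n ^ 3) = 1 := by
  induction n with
  | zero =>
    have h : tripleStaircase 0 = 0 := Subsingleton.elim _ _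
    simp [vandermondePoly, h]
  | succ n ih =>
    rw [tripleStaircase_succ, ← finSuccEquiv_coeff_coeff, finSuccEquiv_vandermondePoly_cube,
      Polynomial.coeff_mul_C, coeff_prod_X_sub_C_cube, one_mul, ih]

/-- The coefficient of `x^{3 δ_n - e_a + e_b}` in `a_{δ_n}^3`. -/
def boxMoveCoeff (a b : ℕ) : ℤ :=
  if b < a then 0 else if a = b then 1 else -3 * (-2) ^ (b - a - 1)

theorem sum_boxMoveCoeff {n : ℕ} (b : Fin n) : ∑ k : Fin n, boxMoveCoeff k b = (-2) ^ (b : ℕ) := by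
  induction n with
  | zero => exact b.elim0
  | succ n ih =>
    rw [Fin.sum_univ_succ]
    cases b using Fin.cases with
    | zero => simp [boxMoveCoeff]
    | succ b =>
      have h (k : Fin n) : boxMoveCoeff k.succ b.succ = boxMoveCoeff k b := by
        simp [boxMoveCoeff]
      simp only [h, ih]
      simp [boxMoveCoeff]
      ring

theorem coeff_X_mul_vandermondePoly_cube {n : ℕ} (a b : Fin n) :
    coeff (tripleStaircase n + Finsupp.single b 1) (X a * vandermondePoly n ^ 3) =
      boxMoveCoeff a b := by
  induction n with
  | zero => exact a.elim0
  | succ n ih =>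
    cases b using Fin.cases with
    | zero =>
      rw [tripleStaircase_succ_add_single_zero, ← finSuccEquiv_coeff_coeff, map_mul,
        finSuccEquiv_vandermondePoly_cube]
      cases a using Fin.cases with
      | zero =>
        rw [finSuccEquiv_X_zero, Polynomial.coeff_X_mul, Polynomial.coeff_mul_C,
          coeff_prod_X_sub_C_cube, one_mul, coeff_tripleStaircase]
        simp [boxMoveCoeff]
      | succ a =>
        rw [finSuccEquiv_X_succ, Polynomial.coeff_C_mul, Polynomial.coeff_mul_C,
          Polynomial.coeff_eq_zero_of_natDegree_lt (by rw [natDegree_prod_X_sub_C_cube]; omega)]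
        simp [boxMoveCoeff]
    | succ b =>
      rw [tripleStaircase_succ_add_single_succ, ← finSuccEquiv_coeff_coeff, map_mul,
        finSuccEquiv_vandermondePoly_cube]
      cases a using Fin.cases with
      | zero =>
        have hn : 0 < n := b.pos
        have hs : 3 * n = 3 * n - 1 + 1 := by omega
        rw [finSuccEquiv_X_zero, hs, Polynomial.coeff_X_mul, Polynomial.coeff_mul_C,
          coeff_prod_X_sub_C_cube_pred _ hn, mul_assoc, Finset.sum_mul,
          show (-3 : MvPolynomial (Fin n) ℤ) = C (-3) by simp, coeff_C_mul, coeff_sum]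
        simp only [ih, sum_boxMoveCoeff]
        simp [boxMoveCoeff]
      | succ a =>
        rw [finSuccEquiv_X_succ, Polynomial.coeff_C_mul, Polynomial.coeff_mul_C,
          coeff_prod_X_sub_C_cube, one_mul, ih]
        simp [boxMoveCoeff]

/-- moving a box from row `j` to row `l` of the staircase partition
`(2(n-1), 2(n-2), …, 2, 0)` gives coefficient `(-1)^{l-j} · 3 · 2^{l-j-1}`. -/
theorem stmt_17 (n j l : ℕ) (hn : 2 ≤ n) (hj1 : 1 ≤ j) (hjn : j ≤ n - 1)
    (hjl : j + 1 ≤ l) (hln : l ≤ n) :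
    schurCoeff n 1
        (fun i : Fin n =>
          if (i : ℕ) = j - 1 then 2 * (n - j) - 1
          else if (i : ℕ) = l - 1 then 2 * (n - l) + 1
          else 2 * (n - 1 - (i : ℕ))) =
      (-1 : ℤ) ^ (l - j) * 3 * 2 ^ (l - j - 1) := by
  have hexp : tripleStaircase n + Finsupp.single (⟨l - 1, by omega⟩ : Fin n) 1 =
      Finsupp.single (⟨j - 1, by omega⟩ : Fin n) 1 +
        Finsupp.equivFunOnFinite.symm fun i : Fin n =>
          (if (i : ℕ) = j - 1 then 2 * (n - j) - 1
            else if (i : ℕ) = l - 1 then 2 * (n - l) + 1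
            else 2 * (n - 1 - (i : ℕ))) + (n - 1 - (i : ℕ)) := by
    ext i
    simp only [tripleStaircase, Finsupp.add_apply, Finsupp.single_apply, Fin.ext_iff,
      Finsupp.equivFunOnFinite_symm_apply_apply]
    split_ifs <;> omega
  have h := coeff_X_mul_vandermondePoly_cube (⟨j - 1, by omega⟩ : Fin n) ⟨l - 1, by omega⟩
  rw [hexp, coeff_X_mul] at h
  obtain ⟨m, rfl⟩ := Nat.exists_eq_add_of_le hjl
  rw [schurCoeff, show 2 * 1 + 1 = 3 from rfl, h, boxMoveCoeff, if_neg (by simp; omega),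
    if_neg (by simp; omega)]
  rw [show j + 1 + m - 1 - (j - 1) - 1 = m by omega, show j + 1 + m - j = m + 1 by omega,
    Nat.add_sub_cancel, neg_pow (2 : ℤ), pow_succ]
  ring
end

section
/- Let n ≥ 4 and let λ = (2n−3, (n−1)^{n−2}, 1) be the partition of n(n−1) with first part 2n−3, then n−2 parts equal to n−1, and last part 1. Then ⟨a_{δ_n}^2, s_λ⟩ = (−1)^{n(n−1)/2 + 1} · 3(n−1) · 1·3·5 ⋯ (2n−7). -/
open MvPolynomial Finset

theorem prod_X_eq_monomial {ι : Type*} (S : Finset ι) :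
    (∏ j ∈ S, X j : MvPolynomial ι ℤ) = monomial (∑ j ∈ S, Finsupp.single j 1) 1 := by
  rw [monomial_sum_one]
  rfl

section Dyson

variable {ι : Type*} [DecidableEq ι]

/-- Multiplying by `X k - X i` extracts the top coefficient in the variable `k`. -/
theorem coeff_mul_X_sub_X_of_degreeOf_le {k i : ι} (hik : i ≠ k) {Q : MvPolynomial ι ℤ} {d : ℕ}
    (hQ : degreeOf k Q ≤ d) {t : ι →₀ ℕ} (ht : t k = d) :
    coeff (t + Finsupp.single k 1) (Q * (X k - X i)) = coeff t Q := by
  rw [mul_sub, coeff_sub, coeff_mul_X, coeff_mul_X']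
  split_ifs with h
  · have : coeff (t + Finsupp.single k 1 - Finsupp.single i 1) Q = 0 := by
      by_contra hne
      have := (degreeOf_le_iff.1 hQ) _ (mem_support_iff.2 hne)
      simp [hik, ht] at this
    rw [this, sub_zero]
  · rw [sub_zero]

theorem degreeOf_mul_X_sub_X_le {k i : ι} {Q : MvPolynomial ι ℤ} {d : ℕ}
    (hQ : degreeOf k Q ≤ d) : degreeOf k (Q * (X k - X i)) ≤ d + 1 := by
  refine (degreeOf_mul_le _ _ _).trans (Nat.add_le_add hQ ?_)
  refine (degreeOf_sub_le _ _ _).trans (max_le ?_ ?_) <;> rw [degreeOf_X] <;> split_ifs <;> simp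

theorem coeff_mul_X_sub_X_pow_of_degreeOf_le {k i : ι} (hik : i ≠ k) {Q : MvPolynomial ι ℤ} {d : ℕ}
    (hQ : degreeOf k Q ≤ d) {t : ι →₀ ℕ} (ht : t k = d) (r : ℕ) :
    degreeOf k (Q * (X k - X i) ^ r) ≤ d + r ∧
      coeff (t + Finsupp.single k r) (Q * (X k - X i) ^ r) = coeff t Q := by
  induction r with
  | zero => simpa using hQ
  | succ r ih =>
    rw [pow_succ, ← mul_assoc]
    refine ⟨degreeOf_mul_X_sub_X_le ih.1, ?_⟩
    rw [Finsupp.single_add, ← add_assoc, coeff_mul_X_sub_X_of_degreeOf_le hik ih.1 (by simp [ht]),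
      ih.2]

theorem coeff_mul_prod_X_sub_X_of_degreeOf_le {k : ι} {Q : MvPolynomial ι ℤ} {d : ℕ}
    (hQ : degreeOf k Q ≤ d) {t : ι →₀ ℕ} (ht : t k = d) (a : ι → ℕ) (S : Finset ι) (hS : k ∉ S) :
    degreeOf k (Q * ∏ i ∈ S, (X k - X i) ^ a i) ≤ d + ∑ i ∈ S, a i ∧
      coeff (t + Finsupp.single k (∑ i ∈ S, a i)) (Q * ∏ i ∈ S, (X k - X i) ^ a i) =
        coeff t Q := by
  induction S using Finset.induction_on with
  | empty => simpa using hQ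
  | insert i S hi ih =>
    obtain ⟨hki, hkS⟩ : k ≠ i ∧ k ∉ S := by simpa using hS
    obtain ⟨h1, h2⟩ := ih hkS
    rw [prod_insert hi, sum_insert hi, mul_comm (_ ^ _), ← mul_assoc, add_comm (a i), ← add_assoc,
      Finsupp.single_add, ← add_assoc]
    have := coeff_mul_X_sub_X_pow_of_degreeOf_le (i := i) hki.symm h1
      (t := t + Finsupp.single k (∑ i ∈ S, a i)) (by simp [ht]) (a i)
    exact ⟨this.1, this.2.trans h2⟩

/-- The polynomial form `∏_{i ≠ j} (x_j - x_i)^{a_i}` of the Dyson product. -/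
noncomputable def dysonProd (S : Finset ι) (a : ι → ℕ) : MvPolynomial ι ℤ :=
  ∏ i ∈ S, ∏ j ∈ S.erase i, (X j - X i) ^ a i

/-- The exponent of the monomial of `dysonProd S a` that is the constant term of the
Dyson product. -/
noncomputable def dysonExp (S : Finset ι) (a : ι → ℕ) : ι →₀ ℕ :=
  ∑ j ∈ S, Finsupp.single j (∑ i ∈ S.erase j, a i)

theorem dysonExp_apply (S : Finset ι) (a : ι → ℕ) (k : ι) :
    dysonExp S a k = if k ∈ S then ∑ i ∈ S.erase k, a i else 0 := by
  simp [dysonExp, Finsupp.finsetSum_apply, Finsupp.single_apply]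

theorem degreeOf_dysonProd_of_notMem {S : Finset ι} (a : ι → ℕ) {k : ι} (hk : k ∉ S) :
    degreeOf k (dysonProd S a) = 0 := by
  refine Nat.le_zero.1 ((degreeOf_prod_le _ _ _).trans (Finset.sum_nonpos fun i hi => ?_))
  refine (degreeOf_prod_le _ _ _).trans (Finset.sum_nonpos fun j hj => ?_)
  refine (degreeOf_pow_le _ _ _).trans ?_
  have h1 : k ≠ i := fun h => hk (h ▸ hi)
  have h2 : k ≠ j := fun h => hk (h ▸ mem_of_mem_erase hj)
  have := degreeOf_sub_le k (X j : MvPolynomial ι ℤ) (X i)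
  simp [degreeOf_X, h1, h2] at this
  simp [this]

theorem coeff_dysonProd_erase {S : Finset ι} {a : ι → ℕ} {k : ι} (hk : k ∈ S) (ha : a k = 0) :
    coeff (dysonExp S a) (dysonProd S a) =
      coeff (dysonExp (S.erase k) a) (dysonProd (S.erase k) a) := by
  have hprod : dysonProd S a =
      dysonProd (S.erase k) a * ∏ i ∈ S.erase k, (X k - X i) ^ a i := by
    rw [dysonProd, dysonProd, ← mul_prod_erase S _ hk, ha]
    simp only [pow_zero, prod_const_one, one_mul]
    rw [← prod_mul_distrib]
    refine prod_congr rfl fun i hi => ?_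
    rw [erase_right_comm, prod_erase_mul]
    exact mem_erase.2 ⟨(ne_of_mem_erase hi).symm, hk⟩
  have hexp : dysonExp S a =
      dysonExp (S.erase k) a + Finsupp.single k (∑ i ∈ S.erase k, a i) := by
    ext j
    simp only [Finsupp.add_apply, dysonExp_apply, Finsupp.single_apply, mem_erase]
    rcases eq_or_ne j k with rfl | hjk
    · simp [hk]
    · by_cases hj : j ∈ S
      · have : k ∈ S.erase j := mem_erase.2 ⟨hjk.symm, hk⟩
        simp [hj, hjk, hjk.symm, ← add_sum_erase _ _ this, ha, erase_right_comm (a := k)]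
      · simp [hj, hjk.symm]
  rw [hprod, hexp]
  exact (coeff_mul_prod_X_sub_X_of_degreeOf_le
    (degreeOf_dysonProd_of_notMem a (notMem_erase k S)).le
    (by simp [dysonExp_apply]) a _ (notMem_erase k S)).2

theorem sum_prod_div_sub_eq_one {K : Type*} [Field K] {S : Finset ι} (hS : S.Nonempty)
    {v : ι → K} (hv : Set.InjOn v S) :
    ∑ k ∈ S, ∏ j ∈ S.erase k, (v j / (v j - v k)) = 1 := by
  have := congrArg (Polynomial.eval 0) (Lagrange.sum_basis hv hS)
  rw [Polynomial.eval_finsetSum, Polynomial.eval_one] at this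
  rw [← this]
  refine sum_congr rfl fun k hk => ?_
  rw [Lagrange.basis, Polynomial.eval_prod]
  refine prod_congr rfl fun j hj => ?_
  rw [Lagrange.basisDivisor]
  simp only [Polynomial.eval_mul, Polynomial.eval_C, Polynomial.eval_sub, Polynomial.eval_X]
  rw [zero_sub, ← neg_sub (v j) (v k), inv_neg, neg_mul_neg, div_eq_inv_mul]

theorem dysonProd_eq_mul {S : Finset ι} {a : ι → ℕ} {k : ι} (hk : k ∈ S) (ha : a k ≠ 0) :
    dysonProd S a =
      dysonProd S (Function.update a k (a k - 1)) * ∏ j ∈ S.erase k, (X j - X k) := by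
  rw [dysonProd, dysonProd, ← mul_prod_erase S _ hk, ← mul_prod_erase S _ hk, mul_right_comm]
  congr 1
  · rw [← prod_mul_distrib]
    refine prod_congr rfl fun j _ => ?_
    rw [Function.update_self, ← pow_succ, Nat.sub_add_cancel (Nat.one_le_iff_ne_zero.2 ha)]
  · refine prod_congr rfl fun i hi => ?_
    rw [Function.update_of_ne (ne_of_mem_erase hi)]

theorem dysonProd_eq_sum {S : Finset ι} (hS : S.Nonempty) {a : ι → ℕ} (ha : ∀ k ∈ S, a k ≠ 0) :
    dysonProd S a = ∑ k ∈ S,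
      dysonProd S (Function.update a k (a k - 1)) * ∏ j ∈ S.erase k, X j := by
  let φ := algebraMap (MvPolynomial ι ℤ) (FractionRing (MvPolynomial ι ℤ))
  have hφ : Function.Injective φ := IsFractionRing.injective _ _
  have hinj : Function.Injective fun i : ι => φ (X i) := hφ.comp (X_injective (R := ℤ))
  apply hφ
  rw [← mul_one (φ (dysonProd S a)), ← sum_prod_div_sub_eq_one hS hinj.injOn, mul_sum, map_sum]
  refine sum_congr rfl fun k hk => ?_
  rw [dysonProd_eq_mul hk (ha k hk), map_mul, map_mul, mul_assoc, map_prod, map_prod,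
    ← prod_mul_distrib]
  congr 1
  refine prod_congr rfl fun j hj => ?_
  rw [map_sub, mul_div_cancel₀]
  exact sub_ne_zero.2 fun h => ne_of_mem_erase hj (hinj h)

theorem dysonExp_eq_update_add {S : Finset ι} {a : ι → ℕ} {k : ι} (hk : k ∈ S) (ha : a k ≠ 0) :
    dysonExp S a = dysonExp S (Function.update a k (a k - 1)) +
      ∑ j ∈ S.erase k, Finsupp.single j 1 := by
  have hk0 : Finsupp.single k (∑ i ∈ S.erase k, Function.update a k (a k - 1) i) =
      Finsupp.single k (∑ i ∈ S.erase k, a i) := by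
    congr 1
    exact sum_congr rfl fun i hi => Function.update_of_ne (ne_of_mem_erase hi) _ _
  rw [dysonExp, dysonExp, ← add_sum_erase _ _ hk, ← add_sum_erase S _ hk, hk0, add_assoc,
    ← sum_add_distrib]
  congr 1
  refine sum_congr rfl fun j hj => ?_
  have hkj : k ∈ S.erase j := mem_erase.2 ⟨(ne_of_mem_erase hj).symm, hk⟩
  rw [← Finsupp.single_add, ← add_sum_erase _ _ hkj, ← add_sum_erase (S.erase j) _ hkj,
    Function.update_self]
  congr 1
  rw [add_right_comm, Nat.sub_add_cancel (Nat.one_le_iff_ne_zero.2 ha)]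
  congr 1
  exact sum_congr rfl fun i hi => (Function.update_of_ne (ne_of_mem_erase hi) _ _).symm

/-- Dyson's constant term identity, by Good's recursion. -/
theorem coeff_dysonProd (S : Finset ι) (a : ι → ℕ) :
    coeff (dysonExp S a) (dysonProd S a) * ∏ i ∈ S, ((a i).factorial : ℤ) =
      ((∑ i ∈ S, a i).factorial : ℤ) := by
  induction h : #S + ∑ i ∈ S, a i using Nat.strong_induction_on generalizing S a with
  | _ N ih =>
  rcases S.eq_empty_or_nonempty with rfl | hS
  · simp [dysonExp, dysonProd]
  by_cases h0 : ∃ k ∈ S, a k = 0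
  · obtain ⟨k, hk, hak⟩ := h0
    have hsum := add_sum_erase S a hk
    have hcard := card_erase_add_one hk
    rw [coeff_dysonProd_erase hk hak, ← mul_prod_erase _ _ hk, hak, Nat.factorial_zero,
      Nat.cast_one, one_mul, ih _ (by omega) _ _ rfl, ← hsum, hak, zero_add]
  · push Not at h0
    obtain ⟨s, hs⟩ : ∃ s, ∑ i ∈ S, a i = s + 1 := by
      obtain ⟨k, hk⟩ := hS
      refine Nat.exists_eq_succ_of_ne_zero fun h => h0 k hk (Finset.sum_eq_zero_iff.1 h k hk)
    have key : ∀ k ∈ S,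
        coeff (dysonExp S a) (dysonProd S (Function.update a k (a k - 1)) * ∏ j ∈ S.erase k, X j) *
          ∏ i ∈ S, ((a i).factorial : ℤ) = a k * (s.factorial : ℤ) := by
      intro k hk
      have hak : a k - 1 + 1 = a k := Nat.sub_add_cancel (Nat.one_le_iff_ne_zero.2 (h0 k hk))
      have hsum : ∑ i ∈ S, Function.update a k (a k - 1) i = s := by
        have h1 := add_sum_erase S a hk
        have h2 := add_sum_erase S (Function.update a k (a k - 1)) hk
        have h3 : ∑ i ∈ S.erase k, Function.update a k (a k - 1) i = ∑ i ∈ S.erase k, a i :=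
          sum_congr rfl fun i hi => Function.update_of_ne (ne_of_mem_erase hi) _ _
        rw [Function.update_self] at h2
        omega
      have hfac : ∏ i ∈ S, ((a i).factorial : ℤ) =
          a k * ∏ i ∈ S, ((Function.update a k (a k - 1) i).factorial : ℤ) := by
        rw [← mul_prod_erase _ _ hk, ← mul_prod_erase S _ hk, Function.update_self, ← mul_assoc,
          ← Nat.cast_mul, ← hak, Nat.add_sub_cancel, ← Nat.factorial_succ]
        congr 1
        exact prod_congr rfl fun i hi => by rw [Function.update_of_ne (ne_of_mem_erase hi)]
      rw [dysonExp_eq_update_add hk (h0 k hk), prod_X_eq_monomial, coeff_mul_monomial, mul_one,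
        hfac, mul_left_comm, ih _ (by omega) _ _ rfl, hsum]
    rw [dysonProd_eq_sum hS h0, coeff_sum, sum_mul, sum_congr rfl key, ← sum_mul, hs,
      Nat.factorial_succ, Nat.cast_mul, ← hs, Nat.cast_sum]

end Dyson

section Pairs

@[to_additive]
theorem prod_prod_erase_eq_prod_lt {m : ℕ} {M : Type*} [CommMonoid M] (f : Fin m → Fin m → M) :
    ∏ i, ∏ j ∈ univ.erase i, f i j =
      ∏ p ∈ univ.filter (fun p : Fin m × Fin m => p.1 < p.2), f p.1 p.2 * f p.2 p.1 := by
  have hswap : ∏ p ∈ univ.filter (fun p : Fin m × Fin m => p.1 < p.2), f p.2 p.1 =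
      ∏ p ∈ univ.filter (fun p : Fin m × Fin m => p.2 < p.1), f p.1 p.2 :=
    prod_nbij' Prod.swap Prod.swap (by simp) (by simp) (by simp) (by simp) (by simp)
  rw [prod_mul_distrib, hswap, ← prod_union]
  · rw [prod_sigma']
    refine prod_nbij' (fun p => (p.1, p.2)) (fun p => ⟨p.1, p.2⟩) ?_ ?_ ?_ ?_ ?_
    · rintro ⟨i, j⟩ h
      simp only [mem_sigma, mem_erase, mem_univ, and_true, true_and, mem_union, mem_filter] at h ⊢
      exact lt_or_gt_of_ne (Ne.symm h)
    · rintro ⟨i, j⟩ h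
      simp only [mem_sigma, mem_erase, mem_univ, and_true, true_and, mem_union, mem_filter] at h ⊢
      exact h.elim (fun h => h.ne') fun h => h.ne
    all_goals simp
  · rw [disjoint_filter]
    exact fun p _ h => h.not_gt

end Pairs

section Vandermonde

variable {m : ℕ}

theorem vandermondePoly_eq_det (m : ℕ) :
    vandermondePoly m = (Matrix.vandermonde fun i : Fin m => -(X i : MvPolynomial (Fin m) ℤ)).det := by
  rw [Matrix.det_vandermonde, vandermondePoly, prod_sigma']
  refine prod_nbij' (fun p => ⟨p.1, p.2⟩) (fun p => (p.1, p.2)) ?_ ?_ ?_ ?_ ?_ <;> simp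
  intros
  ring

theorem rename_vandermondePoly (σ : Equiv.Perm (Fin m)) :
    rename σ (vandermondePoly m) = (Equiv.Perm.sign σ : ℤ) • vandermondePoly m := by
  have h : (rename σ (R := ℤ)).mapMatrix (Matrix.vandermonde fun i => -X i) =
      (Matrix.vandermonde fun i : Fin m => -(X i : MvPolynomial (Fin m) ℤ)).submatrix σ id := by
    ext i j : 2
    simp [Matrix.vandermonde_apply]
  rw [vandermondePoly_eq_det, AlgHom.map_det, h, Matrix.det_permute, zsmul_eq_mul]

theorem vandermondePoly_eq_sum (m : ℕ) :
    vandermondePoly m = ∑ σ : Equiv.Perm (Fin m), monomial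
      (Finsupp.equivFunOnFinite.symm fun j => ((σ.symm j : Fin m) : ℕ))
      ((-1 : ℤ) ^ (m * (m - 1) / 2) * (Equiv.Perm.sign σ : ℤ)) := by
  rw [vandermondePoly_eq_det, Matrix.det_apply]
  refine sum_congr rfl fun σ _ => ?_
  simp only [Matrix.vandermonde_apply]
  have h1 : ∏ i : Fin m, (-(X (σ i) : MvPolynomial (Fin m) ℤ)) ^ (i : ℕ) =
      (-1) ^ (m * (m - 1) / 2) * ∏ j : Fin m, X j ^ ((σ.symm j : Fin m) : ℕ) := by
    simp_rw [neg_pow (X (σ _) : MvPolynomial (Fin m) ℤ)]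
    rw [prod_mul_distrib, prod_pow_eq_pow_sum, Fin.sum_univ_eq_sum_range (fun i => i), sum_range_id,
      ← Equiv.prod_comp σ fun j : Fin m => (X j : MvPolynomial (Fin m) ℤ) ^ ((σ.symm j : Fin m) : ℕ)]
    simp
  rw [h1, monomial_eq, Finsupp.prod_fintype _ _ (by simp), Units.smul_def, zsmul_eq_mul]
  simp
  ring

/-- `B` is antisymmetric under permutation of the variables. -/
def IsAntisymmetric (B : MvPolynomial (Fin m) ℤ) : Prop :=
  ∀ σ : Equiv.Perm (Fin m), rename σ B = (Equiv.Perm.sign σ : ℤ) • B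

theorem isAntisymmetric_vandermondePoly_pow_three :
    IsAntisymmetric (vandermondePoly m ^ 3) := by
  intro σ
  rw [map_pow, rename_vandermondePoly, smul_pow, pow_succ, ← Units.val_pow_eq_pow_val,
    Int.units_sq, Units.val_one, one_mul]

theorem IsAntisymmetric.mul_isSymmetric {B P : MvPolynomial (Fin m) ℤ} (hB : IsAntisymmetric B)
    (hP : P.IsSymmetric) : IsAntisymmetric (B * P) := by
  intro σ
  rw [map_mul, hB σ, hP σ, smul_mul_assoc]

theorem IsAntisymmetric.coeff_comp {B : MvPolynomial (Fin m) ℤ} (hB : IsAntisymmetric B)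
    (f : Fin m → ℕ) (σ : Equiv.Perm (Fin m)) :
    coeff (Finsupp.equivFunOnFinite.symm (f ∘ σ)) B =
      (Equiv.Perm.sign σ : ℤ) * coeff (Finsupp.equivFunOnFinite.symm f) B := by
  have h : (Finsupp.equivFunOnFinite.symm (f ∘ σ)).mapDomain σ =
      Finsupp.equivFunOnFinite.symm f := by
    ext i
    obtain ⟨i, rfl⟩ := σ.surjective i
    rw [Finsupp.mapDomain_apply σ.injective]
    rfl
  rw [← coeff_rename_mapDomain σ σ.injective, h, hB σ, coeff_smul, smul_eq_mul]

theorem coeff_vandermondePoly_mul {B : MvPolynomial (Fin m) ℤ} (hB : IsAntisymmetric B) {N : ℕ}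
    (hN : m ≤ N + 1) :
    coeff (Finsupp.equivFunOnFinite.symm fun _ => N) (vandermondePoly m * B) =
      (-1) ^ (m * (m - 1) / 2) * (m.factorial : ℤ) *
        coeff (Finsupp.equivFunOnFinite.symm fun i : Fin m => N - (i : ℕ)) B := by
  rw [vandermondePoly_eq_sum, sum_mul, coeff_sum]
  have key : ∀ σ : Equiv.Perm (Fin m), coeff (Finsupp.equivFunOnFinite.symm fun _ => N)
      (monomial (Finsupp.equivFunOnFinite.symm fun j => ((σ.symm j : Fin m) : ℕ))
        ((-1 : ℤ) ^ (m * (m - 1) / 2) * (Equiv.Perm.sign σ : ℤ)) * B) =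
      (-1) ^ (m * (m - 1) / 2) *
        coeff (Finsupp.equivFunOnFinite.symm fun i : Fin m => N - (i : ℕ)) B := by
    intro σ
    have hN' : (Finsupp.equivFunOnFinite.symm fun _ : Fin m => N) =
        (Finsupp.equivFunOnFinite.symm fun j => ((σ.symm j : Fin m) : ℕ)) +
          Finsupp.equivFunOnFinite.symm ((fun i : Fin m => N - (i : ℕ)) ∘ σ.symm) := by
      ext j
      simp only [Finsupp.add_apply, Finsupp.equivFunOnFinite_symm_apply_apply, Function.comp_apply]
      have := (σ.symm j).isLt
      omega
    have hsq : (Equiv.Perm.sign σ : ℤ) * (Equiv.Perm.sign σ : ℤ) = 1 := by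
      rw [← Units.val_mul, Int.units_mul_self, Units.val_one]
    rw [hN', coeff_monomial_mul, hB.coeff_comp, Equiv.Perm.sign_symm, mul_assoc,
      ← mul_assoc _ _ (coeff _ _), hsq, one_mul]
  rw [sum_congr rfl fun σ _ => key σ, sum_const, card_univ, Fintype.card_perm, Fintype.card_fin,
    nsmul_eq_mul]
  ring

theorem vandermondePoly_pow_four (m : ℕ) :
    vandermondePoly m ^ 4 = dysonProd univ fun _ : Fin m => 2 := by
  rw [dysonProd, prod_prod_erase_eq_prod_lt (fun i j : Fin m => (X j - X i : MvPolynomial _ ℤ) ^ 2),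
    vandermondePoly, ← prod_pow]
  refine prod_congr rfl fun p _ => ?_
  ring

theorem prod_odd_mul (m : ℕ) :
    (∏ t ∈ range m, (2 * (t : ℤ) + 1)) * (2 ^ m * (m.factorial : ℤ)) = ((2 * m).factorial : ℤ) := by
  induction m with
  | zero => simp
  | succ m ih =>
    rw [show 2 * (m + 1) = 2 * m + 1 + 1 by ring, Nat.factorial_succ, Nat.factorial_succ,
      Nat.factorial_succ, prod_range_succ]
    push_cast
    rw [← ih]
    ring

theorem coeff_vandermondePoly_pow_four (m : ℕ) :
    coeff (Finsupp.equivFunOnFinite.symm fun _ => 2 * m - 2) (vandermondePoly m ^ 4) =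
      (m.factorial : ℤ) * ∏ t ∈ range m, (2 * (t : ℤ) + 1) := by
  have h := coeff_dysonProd (univ : Finset (Fin m)) fun _ => 2
  have hexp : dysonExp (univ : Finset (Fin m)) (fun _ => 2) =
      Finsupp.equivFunOnFinite.symm fun _ => 2 * m - 2 := by
    ext i
    simp [dysonExp_apply]
    omega
  rw [← vandermondePoly_pow_four, hexp] at h
  simp only [prod_const, sum_const, card_univ, Fintype.card_fin, smul_eq_mul, mul_comm m 2,
    ← prod_odd_mul, Nat.factorial_two, Nat.cast_ofNat] at h
  have h2 : (2 : ℤ) ^ m ≠ 0 := by positivity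
  apply mul_right_cancel₀ h2
  rw [h]
  ring

end Vandermonde

section Aomoto

variable {m : ℕ}

/-- The derivation `∑ x_i² ∂_i`. -/
noncomputable def sqEuler (m : ℕ) :
    Derivation ℤ (MvPolynomial (Fin m) ℤ) (MvPolynomial (Fin m) ℤ) :=
  mkDerivation ℤ fun i => X i ^ 2

theorem sqEuler_apply (P : MvPolynomial (Fin m) ℤ) :
    sqEuler m P = ∑ i, X i * (X i * pderiv i P) := by
  have hsum : ∀ Q : MvPolynomial (Fin m) ℤ,
      (∑ i, (X i ^ 2 : MvPolynomial (Fin m) ℤ) • pderiv i : Derivation ℤ _ _) Q =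
        ∑ i, ((X i ^ 2 : MvPolynomial (Fin m) ℤ) • pderiv i : Derivation ℤ _ _) Q := fun Q => by
    rw [← Derivation.coeFnAddMonoidHom_apply, map_sum, Finset.sum_apply]
    rfl
  have : sqEuler m = ∑ i, (X i ^ 2 : MvPolynomial (Fin m) ℤ) • pderiv i := by
    refine derivation_ext fun j => ?_
    rw [sqEuler, mkDerivation_X, hsum, sum_eq_single j]
    · simp
    · intro i _ hij
      simp [pderiv_X_of_ne hij.symm]
    · simp
  rw [this, hsum]
  refine sum_congr rfl fun i _ => ?_
  rw [Derivation.smul_apply, smul_eq_mul]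
  ring

theorem coeff_X_mul_pderiv {ι : Type*} (i : ι) (P : MvPolynomial ι ℤ) (s : ι →₀ ℕ) :
    coeff s (X i * pderiv i P) = s i * coeff s P := by
  classical
  rw [coeff_X_mul']
  split_ifs with h
  · have h1 : s i ≠ 0 := Finsupp.mem_support_iff.1 h
    rw [coeff_pderiv, tsub_add_cancel_of_le (Finsupp.single_le_iff.2 (Nat.one_le_iff_ne_zero.2 h1)),
      mul_comm, Finsupp.tsub_apply, Finsupp.single_eq_same, Nat.cast_sub (by omega)]
    simp
  · rw [Finsupp.notMem_support_iff.1 h, Nat.cast_zero, zero_mul]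

theorem coeff_sqEuler (P : MvPolynomial (Fin m) ℤ) (N : ℕ) :
    coeff (Finsupp.equivFunOnFinite.symm fun _ => N) (sqEuler m P) =
      ((N : ℤ) - 1) * coeff (Finsupp.equivFunOnFinite.symm fun _ => N) ((∑ i, X i) * P) := by
  rw [sqEuler_apply, sum_mul, coeff_sum, coeff_sum, mul_sum]
  refine sum_congr rfl fun i _ => ?_
  rw [coeff_X_mul', coeff_X_mul' _ i P]
  split_ifs with h
  · rw [coeff_X_mul_pderiv]
    congr 1
    have h1 : N ≠ 0 := by simpa using h
    rw [Finsupp.tsub_apply, Finsupp.single_eq_same, Finsupp.equivFunOnFinite_symm_apply_apply]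
    omega
  · rw [mul_zero]

theorem derivation_prod_of_eq_mul {A ι : Type*} [CommRing A] [Algebra ℤ A] (D : Derivation ℤ A A)
    {f g : ι → A} (h : ∀ i, D (f i) = g i * f i) (S : Finset ι) :
    D (∏ i ∈ S, f i) = (∑ i ∈ S, g i) * ∏ i ∈ S, f i := by
  classical
  induction S using Finset.induction_on with
  | empty => simp
  | insert i S hi ih =>
    rw [prod_insert hi, sum_insert hi, Derivation.leibniz, ih, h, smul_eq_mul, smul_eq_mul]
    ring

/-- The elementary symmetric polynomial of degree `m - 1`. -/
noncomputable def esymmPred (m : ℕ) : MvPolynomial (Fin m) ℤ :=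
  ∑ i, ∏ j ∈ univ.erase i, X j

theorem sqEuler_X (i : Fin m) : sqEuler m (X i) = X i * X i := by
  rw [sqEuler, mkDerivation_X, sq]

theorem sqEuler_vandermondePoly (m : ℕ) :
    sqEuler m (vandermondePoly m) = ((m : ℤ) - 1) • ((∑ i, X i) * vandermondePoly m) := by
  rw [vandermondePoly, derivation_prod_of_eq_mul (sqEuler m) (f := fun p => X p.1 - X p.2)
      (g := fun p : Fin m × Fin m => X p.1 + X p.2),
    ← sum_sum_erase_eq_sum_lt (fun i _ : Fin m => (X i : MvPolynomial _ ℤ)), ← smul_mul_assoc]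
  · congr 1
    rw [smul_sum]
    refine sum_congr rfl fun i _ => ?_
    have : 0 < m := i.pos
    rw [sum_const, card_erase_of_mem (mem_univ i), card_univ, Fintype.card_fin, ← natCast_zsmul,
      Nat.cast_sub this, Nat.cast_one]
  · intro p
    rw [map_sub, sqEuler_X, sqEuler_X]
    ring

theorem sqEuler_esymmPred (m : ℕ) :
    sqEuler m (esymmPred m) = (∑ i, X i) * esymmPred m - (m : ℤ) • ∏ i, X i := by
  have h : ∀ i : Fin m, sqEuler m (∏ j ∈ univ.erase i, X j) =
      (∑ j, X j) * ∏ j ∈ univ.erase i, X j - ∏ j, X j := by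
    intro i
    rw [derivation_prod_of_eq_mul _ sqEuler_X, ← add_sum_erase univ _ (mem_univ i),
      ← mul_prod_erase univ _ (mem_univ i)]
    ring
  rw [esymmPred, map_sum, sum_congr rfl fun i _ => h i, sum_sub_distrib, mul_sum, sum_const,
    card_univ, Fintype.card_fin, natCast_zsmul]

theorem prod_univ_X_eq_monomial (m : ℕ) :
    (∏ i, X i : MvPolynomial (Fin m) ℤ) =
      monomial (Finsupp.equivFunOnFinite.symm fun _ => 1) 1 := by
  have h : (∑ i : Fin m, Finsupp.single i 1) = Finsupp.equivFunOnFinite.symm fun _ => 1 := by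
    ext i
    simp [Finsupp.finsetSum_apply, Finsupp.single_apply]
  rw [prod_X_eq_monomial, h]

/-- Integrating `∑ x_i² ∂_i` by parts against `a_δ⁴`. -/
theorem coeff_vandermondePoly_pow_four_mul (hm : 0 < m) :
    (2 * (m : ℤ) - 1) * coeff (Finsupp.equivFunOnFinite.symm fun _ => 2 * m - 1)
        (vandermondePoly m ^ 4 * ((∑ i, X i) * esymmPred m)) =
      m * coeff (Finsupp.equivFunOnFinite.symm fun _ => 2 * m - 2) (vandermondePoly m ^ 4) := by
  have h := coeff_sqEuler (vandermondePoly m ^ 4 * esymmPred m) (2 * m - 1)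
  have hL : sqEuler m (vandermondePoly m ^ 4 * esymmPred m) =
      (4 * ((m : ℤ) - 1) + 1) • (vandermondePoly m ^ 4 * ((∑ i, X i) * esymmPred m)) -
        (m : ℤ) • (vandermondePoly m ^ 4 * ∏ i, X i) := by
    rw [Derivation.leibniz, Derivation.leibniz_pow, sqEuler_vandermondePoly, sqEuler_esymmPred]
    simp only [zsmul_eq_mul, smul_eq_mul, nsmul_eq_mul]
    push_cast
    ring
  have hexp : (Finsupp.equivFunOnFinite.symm fun _ : Fin m => 2 * m - 1) =
      (Finsupp.equivFunOnFinite.symm fun _ => 2 * m - 2) +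
        Finsupp.equivFunOnFinite.symm fun _ => 1 := by
    ext i
    simp only [Finsupp.add_apply, Finsupp.equivFunOnFinite_symm_apply_apply]
    omega
  have hD : coeff (Finsupp.equivFunOnFinite.symm fun _ => 2 * m - 1)
      (vandermondePoly m ^ 4 * ∏ i, X i) =
        coeff (Finsupp.equivFunOnFinite.symm fun _ => 2 * m - 2) (vandermondePoly m ^ 4) := by
    rw [hexp, prod_univ_X_eq_monomial, coeff_mul_monomial, mul_one]
  rw [hL, coeff_sub, coeff_smul, coeff_smul, hD, mul_left_comm (∑ i, X i), Nat.cast_sub (by omega),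
    smul_eq_mul, smul_eq_mul] at h
  push_cast at h
  linear_combination h

end Aomoto

section Coefficients

variable {m : ℕ}

theorem isSymmetric_sum_X : (∑ i, X i : MvPolynomial (Fin m) ℤ).IsSymmetric := by
  intro σ
  rw [map_sum, ← Equiv.sum_comp σ fun i => (X i : MvPolynomial (Fin m) ℤ)]
  simp

theorem isSymmetric_esymmPred : (esymmPred m).IsSymmetric := by
  intro σ
  rw [esymmPred, map_sum, ← Equiv.sum_comp σ fun i => ∏ j ∈ univ.erase i, X j]
  refine sum_congr rfl fun i _ => ?_
  rw [map_prod]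
  refine prod_nbij σ (by simp) σ.injective.injOn ?_ (by simp)
  intro j hj
  exact ⟨σ.symm j, by simpa [Equiv.symm_apply_eq] using hj, by simp⟩

theorem neg_one_pow_mul_self (k : ℕ) : (-1 : ℤ) ^ k * (-1) ^ k = 1 := by
  rw [← mul_pow, neg_one_mul, neg_neg, one_pow]

theorem coeff_vandermondePoly_pow_three (m : ℕ) :
    coeff (Finsupp.equivFunOnFinite.symm fun i : Fin m => 2 * m - 2 - (i : ℕ))
        (vandermondePoly m ^ 3) =
      (-1) ^ (m * (m - 1) / 2) * ∏ t ∈ range m, (2 * (t : ℤ) + 1) := by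
  have h := coeff_vandermondePoly_mul (isAntisymmetric_vandermondePoly_pow_three (m := m))
    (N := 2 * m - 2)
  rcases m.eq_zero_or_pos with rfl | hm
  · simp [vandermondePoly, coeff_one]
    ext i
    exact i.elim0
  replace h := h (by omega)
  rw [← pow_succ', coeff_vandermondePoly_pow_four] at h
  apply mul_left_cancel₀ (Nat.cast_ne_zero.2 m.factorial_ne_zero : (m.factorial : ℤ) ≠ 0)
  rw [mul_left_comm, h, ← mul_assoc, ← mul_assoc, neg_one_pow_mul_self, one_mul]

theorem coeff_vandermondePoly_pow_three_mul (k : ℕ) :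
    coeff (Finsupp.equivFunOnFinite.symm fun i : Fin (k + 1) => 2 * (k + 1) - 1 - (i : ℕ))
        (vandermondePoly (k + 1) ^ 3 * ((∑ i, X i) * esymmPred (k + 1))) =
      (-1) ^ ((k + 1) * k / 2) * ((k + 1) * ∏ t ∈ range k, (2 * (t : ℤ) + 1)) := by
  have h := coeff_vandermondePoly_mul (isAntisymmetric_vandermondePoly_pow_three.mul_isSymmetric
    ((isSymmetric_sum_X (m := k + 1)).mul isSymmetric_esymmPred)) (N := 2 * (k + 1) - 1) (by omega)
  have hT := coeff_vandermondePoly_pow_four_mul (m := k + 1) k.succ_pos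
  rw [← mul_assoc, ← pow_succ'] at h
  rw [h, coeff_vandermondePoly_pow_four, prod_range_succ, Nat.add_sub_cancel] at hT
  have h1 : ((k + 1).factorial : ℤ) ≠ 0 := Nat.cast_ne_zero.2 (Nat.factorial_ne_zero _)
  have h2 : (2 * (k : ℤ) + 1) ≠ 0 := by omega
  have h3 := neg_one_pow_mul_self ((k + 1) * k / 2)
  apply mul_left_cancel₀ (mul_ne_zero h2 h1)
  generalize coeff (Finsupp.equivFunOnFinite.symm fun i : Fin (k + 1) => 2 * (k + 1) - 1 - (i : ℕ))
    (vandermondePoly (k + 1) ^ 3 * ((∑ i, X i) * esymmPred (k + 1))) = c at hT ⊢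
  push_cast at hT
  linear_combination (-1) ^ ((k + 1) * k / 2) * hT - (2 * (k : ℤ) + 1) * (k + 1).factorial * c * h3

end Coefficients

section Peeling

variable {m : ℕ}

theorem vandermondePoly_eq_prod_Ioi (m : ℕ) :
    vandermondePoly m = ∏ i, ∏ j ∈ Ioi i, (X i - X j) := by
  rw [vandermondePoly, prod_sigma']
  refine prod_nbij' (fun p => ⟨p.1, p.2⟩) (fun p => (p.1, p.2)) ?_ ?_ ?_ ?_ ?_ <;> simp

/-- The monic polynomial with roots the variables `x_i`. -/
noncomputable def rootsPoly (m : ℕ) : Polynomial (MvPolynomial (Fin m) ℤ) :=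
  ∏ j, (Polynomial.X - Polynomial.C (X j))

theorem finSuccEquiv_vandermondePoly_s19 (m : ℕ) :
    finSuccEquiv ℤ m (vandermondePoly (m + 1)) =
      rootsPoly m * Polynomial.C (vandermondePoly m) := by
  rw [vandermondePoly_eq_prod_Ioi, vandermondePoly_eq_prod_Ioi, Fin.prod_univ_succ, map_mul,
    Fin.prod_Ioi_zero, rootsPoly]
  simp only [Fin.prod_Ioi_succ, map_prod, map_sub, finSuccEquiv_X_zero, finSuccEquiv_X_succ]

theorem finSuccEquiv_sum_X (m : ℕ) :
    finSuccEquiv ℤ m (∑ i, X i) = Polynomial.X + Polynomial.C (∑ i, X i) := by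
  simp only [Fin.sum_univ_succ, map_add, map_sum, finSuccEquiv_X_zero, finSuccEquiv_X_succ]

theorem monic_rootsPoly (m : ℕ) : (rootsPoly m).Monic :=
  Polynomial.monic_prod_of_monic _ _ fun _ _ => Polynomial.monic_X_sub_C _

theorem natDegree_rootsPoly (m : ℕ) : (rootsPoly m).natDegree = m := by
  rw [rootsPoly, Polynomial.natDegree_prod_of_monic _ _ fun _ _ => Polynomial.monic_X_sub_C _]
  simp

theorem coeff_rootsPoly_pow_three (hm : 0 < m) :
    (rootsPoly m ^ 3).coeff (3 * m - 1) = -3 * ∑ i, X i := by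
  have hdeg : (rootsPoly m ^ 3).natDegree = 3 * m := by
    rw [(monic_rootsPoly m).natDegree_pow, natDegree_rootsPoly]
  have h := Polynomial.nextCoeff_of_natDegree_pos (p := rootsPoly m ^ 3) (by omega)
  rw [← hdeg, ← h, (monic_rootsPoly m).nextCoeff_pow, rootsPoly, Polynomial.prod_X_sub_C_nextCoeff,
    nsmul_eq_mul]
  push_cast
  ring

theorem coeff_zero_rootsPoly (m : ℕ) : (rootsPoly m).coeff 0 = (-1) ^ m * ∏ i, X i := by
  rw [rootsPoly, Polynomial.coeff_zero_prod]
  simp [Finset.prod_neg]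

theorem coeff_one_rootsPoly (m : ℕ) : (rootsPoly m).coeff 1 = -(-1) ^ m * esymmPred m := by
  have h : (rootsPoly m).coeff 1 = (Polynomial.derivative (rootsPoly m)).coeff 0 := by
    rw [Polynomial.coeff_derivative]
    simp
  rw [h, rootsPoly, Polynomial.derivative_prod_finset, Polynomial.finsetSum_coeff, esymmPred,
    mul_sum]
  refine sum_congr rfl fun i _ => ?_
  have hm : (-1 : MvPolynomial (Fin m) ℤ) ^ m = (-1) ^ (m - 1) * -1 := by
    rw [← pow_succ, Nat.sub_add_cancel i.pos]
  rw [Polynomial.mul_coeff_zero, Polynomial.coeff_zero_prod]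
  simp only [Polynomial.coeff_sub, Polynomial.coeff_X_zero, Polynomial.coeff_C_zero, zero_sub,
    Polynomial.derivative_X_sub_C, Polynomial.coeff_one_zero, mul_one, Finset.prod_neg,
    card_erase_of_mem (mem_univ i), card_univ, Fintype.card_fin]
  rw [hm]
  ring

theorem coeff_cons_eq {m : ℕ} (a : ℕ) (f : Fin m → ℕ) (P : MvPolynomial (Fin (m + 1)) ℤ) :
    coeff (Finsupp.equivFunOnFinite.symm (Fin.cons a f : Fin (m + 1) → ℕ)) P =
      coeff (Finsupp.equivFunOnFinite.symm f) ((finSuccEquiv ℤ m P).coeff a) := by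
  rw [finSuccEquiv_coeff_coeff]
  rfl

theorem coeff_cons_vandermondePoly_pow_three (hm : 0 < m) (f : Fin m → ℕ) :
    coeff (Finsupp.equivFunOnFinite.symm (Fin.cons (3 * m - 1) f : Fin (m + 1) → ℕ))
        (vandermondePoly (m + 1) ^ 3) =
      -3 * coeff (Finsupp.equivFunOnFinite.symm f) (vandermondePoly m ^ 3 * ∑ i, X i) := by
  have h3 : (-3 : MvPolynomial (Fin m) ℤ) = C (-3) := by simp
  rw [coeff_cons_eq, map_pow, finSuccEquiv_vandermondePoly_s19, mul_pow, ← Polynomial.C_pow,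
    Polynomial.coeff_mul_C, coeff_rootsPoly_pow_three hm, h3, mul_assoc, coeff_C_mul,
    mul_comm (∑ i, X i)]

theorem coeff_cons_one_vandermondePoly_pow_three_mul (f : Fin m → ℕ) :
    coeff (Finsupp.equivFunOnFinite.symm (Fin.cons 1 f : Fin (m + 1) → ℕ))
        (vandermondePoly (m + 1) ^ 3 * ∑ i, X i) =
      (-1) ^ m * (coeff (Finsupp.equivFunOnFinite.symm f) (vandermondePoly m ^ 3 * (∏ i, X i) ^ 3) -
        3 * coeff (Finsupp.equivFunOnFinite.symm f)
          (vandermondePoly m ^ 3 * ((∑ i, X i) * esymmPred m) * (∏ i, X i) ^ 2)) := by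
  have hsq : ((-1) ^ m * (-1) ^ m : MvPolynomial (Fin m) ℤ) = 1 := by
    rw [← mul_pow, neg_one_mul, neg_neg, one_pow]
  have h : (finSuccEquiv ℤ m (vandermondePoly (m + 1) ^ 3 * ∑ i, X i)).coeff 1 =
      C ((-1) ^ m) * (vandermondePoly m ^ 3 * (∏ i, X i) ^ 3 -
        C 3 * (vandermondePoly m ^ 3 * ((∑ i, X i) * esymmPred m) * (∏ i, X i) ^ 2)) := by
    rw [map_mul, map_pow, finSuccEquiv_vandermondePoly_s19, finSuccEquiv_sum_X, mul_pow,
      ← Polynomial.C_pow, pow_succ (rootsPoly m), sq]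
    simp only [Polynomial.mul_coeff_one, Polynomial.mul_coeff_zero, Polynomial.coeff_add,
      Polynomial.coeff_X_zero, Polynomial.coeff_X_one, Polynomial.coeff_C_zero,
      Polynomial.coeff_C_succ, coeff_zero_rootsPoly, coeff_one_rootsPoly]
    simp only [map_pow, map_neg, map_one, map_ofNat]
    linear_combination (-1) ^ m * (vandermondePoly m ^ 3 * (∏ i, X i) ^ 3 -
        3 * (vandermondePoly m ^ 3 * ((∑ i, X i) * esymmPred m) * (∏ i, X i) ^ 2)) * hsq
  rw [coeff_cons_eq, h, coeff_C_mul, coeff_sub, coeff_C_mul]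

theorem coeff_add_mul_prod_X_pow (f : Fin m → ℕ) (r : ℕ) (P : MvPolynomial (Fin m) ℤ) :
    coeff (Finsupp.equivFunOnFinite.symm fun i => f i + r) (P * (∏ i, X i) ^ r) =
      coeff (Finsupp.equivFunOnFinite.symm f) P := by
  have h : (Finsupp.equivFunOnFinite.symm fun i => f i + r) = Finsupp.equivFunOnFinite.symm f +
      r • Finsupp.equivFunOnFinite.symm fun _ : Fin m => 1 := by
    ext i
    simp
  rw [prod_univ_X_eq_monomial, monomial_pow, one_pow, h, coeff_mul_monomial, mul_one]

end Peeling

/-- the coefficient of `s_{(2n-3, (n-1)^{n-2}, 1)}`. -/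
theorem stmt_19 (n : ℕ) (hn : 4 ≤ n) :
    schurCoeff n 1
        (fun j : Fin n =>
          if (j : ℕ) = 0 then 2 * n - 3
          else if (j : ℕ) = n - 1 then 1
          else n - 1) =
      (-1 : ℤ) ^ (n * (n - 1) / 2 + 1) * (3 * ((n : ℤ) - 1)) *
        ∏ t ∈ Finset.range (n - 3), (2 * (t : ℤ) + 1) := by
  obtain ⟨k, rfl⟩ : ∃ k, n = k + 3 := ⟨n - 3, by omega⟩
  let f : Fin (k + 1) → ℕ := fun i => 2 * (k + 1) + 1 - (i : ℕ)
  have hexp : (fun i : Fin (k + 3) => (if (i : ℕ) = 0 then 2 * (k + 3) - 3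
      else if (i : ℕ) = k + 3 - 1 then 1 else k + 3 - 1) + (k + 3 - 1 - (i : ℕ))) =
      Fin.cons (3 * (k + 2) - 1) ((Fin.cons 1 f : Fin (k + 2) → ℕ) ∘ finRotate (k + 2)) := by
    have hsnoc : (Fin.cons 1 f : Fin (k + 2) → ℕ) ∘ finRotate (k + 2) =
        (Fin.snoc f 1 : Fin (k + 2) → ℕ) := (Fin.snoc_eq_cons_rotate f 1).symm
    rw [hsnoc]
    funext i
    refine Fin.cases ?_ (fun i => ?_) i
    · simp
      omega
    · refine Fin.lastCases ?_ (fun i => ?_) i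
      · simp
      · have := i.isLt
        simp [f, this.ne]
        omega
  have hf2 : f = fun i : Fin (k + 1) => 2 * (k + 1) - 1 - (i : ℕ) + 2 := by
    funext i
    have := i.isLt
    simp only [f]
    omega
  have hf3 : f = fun i : Fin (k + 1) => 2 * (k + 1) - 2 - (i : ℕ) + 3 := by
    funext i
    have := i.isLt
    simp only [f]
    omega
  have hsign : (k + 3) * (k + 3 - 1) / 2 + 1 = (k + 1) * k / 2 + 2 * (k + 2) := by
    have : (k + 3) * (k + 3 - 1) = (k + 1) * k + (2 * k + 3) * 2 := by
      rw [Nat.add_sub_assoc (by norm_num)]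
      ring
    rw [this, Nat.add_mul_div_right _ _ (by norm_num)]
    ring
  have h1 : coeff (Finsupp.equivFunOnFinite.symm f)
      (vandermondePoly (k + 1) ^ 3 * (∏ i, X i) ^ 3) =
      (-1) ^ ((k + 1) * k / 2) * ∏ t ∈ range (k + 1), (2 * (t : ℤ) + 1) := by
    rw [hf3, coeff_add_mul_prod_X_pow, coeff_vandermondePoly_pow_three, Nat.add_sub_cancel]
  have h2 : coeff (Finsupp.equivFunOnFinite.symm f) (vandermondePoly (k + 1) ^ 3 *
      ((∑ i, X i) * esymmPred (k + 1)) * (∏ i, X i) ^ 2) =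
      (-1) ^ ((k + 1) * k / 2) * ((k + 1) * ∏ t ∈ range k, (2 * (t : ℤ) + 1)) := by
    rw [hf2, coeff_add_mul_prod_X_pow, coeff_vandermondePoly_pow_three_mul]
  rw [schurCoeff, hexp, coeff_cons_vandermondePoly_pow_three (by omega),
    (isAntisymmetric_vandermondePoly_pow_three.mul_isSymmetric isSymmetric_sum_X).coeff_comp,
    coeff_cons_one_vandermondePoly_pow_three_mul, h1, h2, sign_finRotate, prod_range_succ, hsign,
    pow_add _ _ (2 * (k + 2)), pow_mul _ 2, neg_one_sq, one_pow]
  have h3 := neg_one_pow_mul_self (k + 1)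
  simp only [Units.val_pow_eq_pow_val, Units.val_neg, Units.val_one, Nat.add_sub_cancel]
  push_cast
  linear_combination (3 * (-1) ^ ((k + 1) * k / 2) * ((k : ℤ) + 2) *
    ∏ t ∈ range k, (2 * (t : ℤ) + 1)) * h3
end
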